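/- arXiv:1210.6964 — 3 statements merged into one kernel-verified Lean document; each statement's English description precedes it below -/
import Mathlib

section
/- Let H be a finite-dimensional Hopf algebra over a field k with an R-matrix R, monodromy matrix Q = R₂₁·R, and a ribbon element v, and assume H is factorizable in the sense that the Drinfeld map f_{Q⁻¹} : H* → H is bijective. Let λ be a nonzero right cointegral and Λ a nonzero two-sided integral with λ(Λ) ≠ 0, and assume every left integral of H is a scalar multiple of Λ. Let ω : H → H be a ribbon Hopf algebra automorphism, i.e. a bijective linear map that is simultaneously an algebra homomorphism and a coalgebra homomorphism, commutes with the antipode S, and satisfies ω(v) = v and (ω⊗ω)(R) = R. Then ω preserves the cointegral and the integral: λ ∘ ω = λ and ω(Λ) = Λ. -/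
open scoped TensorProduct

/-- `(φ ⊗ id)` applied to an element of `H ⊗ H`. -/
noncomputable def pairLeft (k H : Type) [Field k] [Ring H] [Algebra k H]
    (φ : H →ₗ[k] k) : H ⊗[k] H →ₗ[k] H :=
  TensorProduct.lift ((LinearMap.lsmul k H).comp φ)

/-- `(φ ⊗ id)((a ⊗ b) t) = b · (φ(a ·) ⊗ id)(t)`. -/
theorem pairLeft_tmul_mul {k H : Type} [Field k] [Ring H] [Algebra k H]
    (φ : H →ₗ[k] k) (a b : H) (t : H ⊗[k] H) :
    pairLeft k H φ ((a ⊗ₜ[k] b) * t) =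
      b * pairLeft k H (φ.comp (LinearMap.mulLeft k a)) t := by
  induction t with
  | zero => simp
  | tmul x y => simp [pairLeft]
  | add x y hx hy => rw [mul_add, map_add, map_add, mul_add, hx, hy]

theorem pairLeft_map {k H : Type} [Field k] [Ring H] [Algebra k H]
    (φ : H →ₗ[k] k) (f : H →ₗ[k] H) (t : H ⊗[k] H) :
    pairLeft k H φ (TensorProduct.map f f t) = f (pairLeft k H (φ.comp f) t) := by
  induction t with
  | zero => simp
  | tmul x y => simp [pairLeft]
  | add x y hx hy => simp only [map_add, hx, hy]

/-- A right cointegral pulled back along an injective coalgebra endomorphism preserving `1` is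
again a right cointegral. -/
theorem pairLeft_comul_comp {k H : Type} [Field k] [Ring H] [HopfAlgebra k H]
    {lam : H →ₗ[k] k}
    (hlam : ∀ h : H, pairLeft k H lam (Coalgebra.comul (R := k) h) = lam h • (1 : H))
    {f : H →ₗ[k] H} (hinj : Function.Injective f) (hone : f 1 = 1)
    (hcomul : ∀ h : H, Coalgebra.comul (R := k) (f h) =
      TensorProduct.map f f (Coalgebra.comul (R := k) h)) (h : H) :
    pairLeft k H (lam.comp f) (Coalgebra.comul (R := k) h) = (lam.comp f) h • (1 : H) := by
  apply hinj
  rw [← pairLeft_map, ← hcomul, hlam, map_smul, hone, LinearMap.comp_apply]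

/-- The Drinfeld map of `Q⁻¹` sends `lam(v ·)` to `lam(v) v⁻¹` for every right cointegral `lam`. -/
theorem pairLeft_cointegral_ribbon {k H : Type} [Field k] [Ring H] [HopfAlgebra k H]
    {Qinv : H ⊗[k] H} {v v' : H} (hv : v' * v = 1)
    (hvcomul : Coalgebra.comul (R := k) v = (v ⊗ₜ[k] v) * Qinv)
    {lam : H →ₗ[k] k}
    (hlam : ∀ h : H, pairLeft k H lam (Coalgebra.comul (R := k) h) = lam h • (1 : H)) :
    pairLeft k H (lam.comp (LinearMap.mulLeft k v)) Qinv = lam v • v' := by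
  have h := hlam v
  rw [hvcomul, pairLeft_tmul_mul] at h
  have h' := congrArg (v' * ·) h
  simpa [← mul_assoc, hv] using h'

/-- A ribbon Hopf algebra automorphism of a finite-dimensional factorizable
ribbon Hopf algebra preserves the (right) cointegral and the (two-sided) integral. -/
theorem ribbon_automorphism_preserves_integrals
    (k H : Type) [Field k] [Ring H] [HopfAlgebra k H] [FiniteDimensional k H]
    (Rm Rm' : H ⊗[k] H) (hinv₁ : Rm * Rm' = 1) (hinv₂ : Rm' * Rm = 1)
    (hconj : ∀ h : H, Rm * Coalgebra.comul (R := k) h * Rm' =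
      TensorProduct.comm k H H (Coalgebra.comul (R := k) h))
    (Qinv : H ⊗[k] H)
    (hQ₁ : (TensorProduct.comm k H H Rm * Rm) * Qinv = 1)
    (hQ₂ : Qinv * (TensorProduct.comm k H H Rm * Rm) = 1)
    (v v' : H) (hv₁ : v * v' = 1) (hv₂ : v' * v = 1)
    (hvcentral : ∀ h : H, v * h = h * v)
    (hvcounit : Coalgebra.counit (R := k) v = 1)
    (hvantipode : HopfAlgebra.antipode (R := k) v = v)
    (hvcomul : Coalgebra.comul (R := k) v = (v ⊗ₜ[k] v) * Qinv)
    -- factorizability: the Drinfeld map `f_{Q⁻¹}` is bijective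
    (hfact : Function.Bijective fun φ : Module.Dual k H => pairLeft k H φ Qinv)
    -- a nonzero right cointegral
    (lam : H →ₗ[k] k) (hlamne : lam ≠ 0)
    (hlam : ∀ h : H, pairLeft k H lam (Coalgebra.comul (R := k) h) = lam h • (1 : H))
    -- a nonzero two-sided integral, pairing nontrivially with `lam`
    (Λ : H) (hΛne : Λ ≠ 0)
    (hΛl : ∀ h : H, h * Λ = Coalgebra.counit (R := k) h • Λ)
    (hΛr : ∀ h : H, Λ * h = Coalgebra.counit (R := k) h • Λ)
    (hpair : lam Λ ≠ 0)
    -- uniqueness of left integrals up to scalar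
    (hunique : ∀ x : H, (∀ h : H, h * x = Coalgebra.counit (R := k) h • x) → ∃ c : k, x = c • Λ)
    -- a ribbon Hopf algebra automorphism
    (ω : H →ₗ[k] H) (hωbij : Function.Bijective ω)
    (hωmul : ∀ x y : H, ω (x * y) = ω x * ω y) (hωone : ω 1 = 1)
    (hωcomul : ∀ h : H, Coalgebra.comul (R := k) (ω h) =
      TensorProduct.map ω ω (Coalgebra.comul (R := k) h))
    (hωcounit : ∀ h : H, Coalgebra.counit (R := k) (ω h) = Coalgebra.counit (R := k) h)
    (hωS : ∀ h : H, ω (HopfAlgebra.antipode (R := k) h) = HopfAlgebra.antipode (R := k) (ω h))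
    (hωv : ω v = v)
    (hωR : TensorProduct.map ω ω Rm = Rm) :
    (∀ h : H, lam (ω h) = lam h) ∧ ω Λ = Λ := by
  have hlamω : lam.comp ω = lam := by
    have hcomp := pairLeft_cointegral_ribbon hv₂ hvcomul
      (pairLeft_comul_comp hlam hωbij.injective hωone hωcomul)
    rw [LinearMap.comp_apply, hωv, ← pairLeft_cointegral_ribbon hv₂ hvcomul hlam] at hcomp
    have heq := hfact.injective hcomp
    ext h
    have hh := LinearMap.congr_fun heq (v' * h)
    simpa [← mul_assoc, hv₁] using hh
  have hlamω' (h : H) : lam (ω h) = lam h := LinearMap.congr_fun hlamω h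
  refine ⟨hlamω', ?_⟩
  obtain ⟨c, hc⟩ := hunique (ω Λ) fun h => by
    obtain ⟨g, rfl⟩ := hωbij.surjective h
    rw [← hωmul, hΛl, map_smul, hωcounit]
  have hcΛ : c * lam Λ = lam Λ := by
    rw [← smul_eq_mul, ← map_smul, ← hc, hlamω']
  rw [hc, (mul_eq_right₀ hpair).mp hcΛ, one_smul]
end

section
/- Let H be a Hopf algebra over a field k and let Λ ∈ H be a two-sided integral. Then for all h ∈ H the following two identities hold in H⊗H: Σ Λ₍₁₎h ⊗ Λ₍₂₎ = Σ Λ₍₁₎ ⊗ Λ₍₂₎S(h), and Σ Λ₍₁₎ ⊗ hΛ₍₂₎ = Σ S(h)Λ₍₁₎ ⊗ Λ₍₂₎. -/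
open scoped TensorProduct

open Coalgebra HopfAlgebra in
/-- `Σ h₍₁₎ ⊗ h₍₂₎S(h₍₃₎) = h ⊗ 1`. -/
theorem sum_comul_mul_one_tmul_antipode {R A ι : Type*} [CommSemiring R] [Semiring A]
    [HopfAlgebra R A] {h : A} (r : Repr R h ι) :
    ∑ i ∈ r.index, comul (R := R) (r.left i) * ((1 : A) ⊗ₜ[R] antipode R (r.right i)) =
      h ⊗ₜ[R] (1 : A) := by
  have key (x : A ⊗[R] A) (b : A) : x * ((1 : A) ⊗ₜ[R] antipode R b) =
      (LinearMap.mul' R A ∘ₗ (antipode R).lTensor A).lTensor A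
        (TensorProduct.assoc R A A A (x ⊗ₜ[R] b)) := by
    induction x with
    | zero => simp
    | tmul x y => simp
    | add x y hx hy => simp only [add_mul, hx, hy, TensorProduct.add_tmul, map_add]
  have hr : ∑ i ∈ r.index, comul (R := R) (r.left i) ⊗ₜ[R] r.right i =
      (comul (R := R) (A := A)).rTensor A (comul h) := by
    simp [← r.eq]
  simp only [key, ← map_sum, hr]
  rw [coassoc_apply, ← LinearMap.comp_apply, ← LinearMap.lTensor_comp, LinearMap.comp_assoc,
    mul_antipode_lTensor_comul, LinearMap.lTensor_comp, LinearMap.comp_apply,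
    lTensor_counit_comul]
  simp

open Coalgebra HopfAlgebra in
/-- `Σ S(h₍₁₎)h₍₂₎ ⊗ h₍₃₎ = 1 ⊗ h`. -/
theorem sum_antipode_tmul_one_mul_comul {R A ι : Type*} [CommSemiring R] [Semiring A]
    [HopfAlgebra R A] {h : A} (r : Repr R h ι) :
    ∑ i ∈ r.index, (antipode R (r.left i) ⊗ₜ[R] (1 : A)) * comul (R := R) (r.right i) =
      (1 : A) ⊗ₜ[R] h := by
  have key (a : A) (x : A ⊗[R] A) : (antipode R a ⊗ₜ[R] (1 : A)) * x =
      (LinearMap.mul' R A ∘ₗ (antipode R).rTensor A).rTensor A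
        ((TensorProduct.assoc R A A A).symm (a ⊗ₜ[R] x)) := by
    induction x with
    | zero => simp
    | tmul x y => simp
    | add x y hx hy => simp only [mul_add, hx, hy, TensorProduct.tmul_add, map_add]
  have hr : ∑ i ∈ r.index, r.left i ⊗ₜ[R] comul (R := R) (r.right i) =
      (comul (R := R) (A := A)).lTensor A (comul h) := by
    simp [← r.eq]
  simp only [key, ← map_sum, hr]
  rw [coassoc_symm_apply, ← LinearMap.comp_apply, ← LinearMap.rTensor_comp, LinearMap.comp_assoc,
    mul_antipode_rTensor_comul, LinearMap.rTensor_comp, LinearMap.comp_apply,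
    rTensor_counit_comul]
  simp

/-- For a Hopf algebra `H` over a field `k` with a two-sided integral `Λ`,
for all `h ∈ H` one has `Σ Λ₍₁₎h ⊗ Λ₍₂₎ = Σ Λ₍₁₎ ⊗ Λ₍₂₎S(h)` and
`Σ Λ₍₁₎ ⊗ hΛ₍₂₎ = Σ S(h)Λ₍₁₎ ⊗ Λ₍₂₎` in `H ⊗ H`. -/
theorem integral_comul_identities
    (k H : Type) [Field k] [Ring H] [HopfAlgebra k H]
    (Λ : H)
    (hΛl : ∀ h : H, h * Λ = Coalgebra.counit (R := k) h • Λ)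
    (hΛr : ∀ h : H, Λ * h = Coalgebra.counit (R := k) h • Λ) :
    ∀ h : H,
      Coalgebra.comul (R := k) Λ * (h ⊗ₜ[k] (1 : H)) =
        Coalgebra.comul (R := k) Λ * ((1 : H) ⊗ₜ[k] (HopfAlgebra.antipode (R := k) h)) ∧
      ((1 : H) ⊗ₜ[k] h) * Coalgebra.comul (R := k) Λ =
        ((HopfAlgebra.antipode (R := k) h) ⊗ₜ[k] (1 : H)) * Coalgebra.comul (R := k) Λ := by
  intro h
  let r := Coalgebra.Repr.arbitrary k h
  have hS : HopfAlgebra.antipode k h =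
      ∑ i ∈ r.index, Coalgebra.counit (R := k) (r.left i) •
        HopfAlgebra.antipode k (r.right i) := by
    rw [← congrArg (HopfAlgebra.antipode k) (Coalgebra.sum_counit_smul r)]
    simp
  have hS' : HopfAlgebra.antipode k h =
      ∑ i ∈ r.index, Coalgebra.counit (R := k) (r.right i) •
        HopfAlgebra.antipode k (r.left i) := by
    have := congrArg (TensorProduct.rid k H) (Coalgebra.sum_tmul_counit_eq r)
    simp only [map_sum, TensorProduct.rid_tmul, one_smul] at this
    rw [← congrArg (HopfAlgebra.antipode k) this]
    simp
  constructor
  · rw [← sum_comul_mul_one_tmul_antipode r, Finset.mul_sum, hS, TensorProduct.tmul_sum,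
      Finset.mul_sum]
    refine Finset.sum_congr rfl fun i _ => ?_
    rw [← mul_assoc, ← Bialgebra.comul_mul, hΛr, map_smul, TensorProduct.tmul_smul,
      smul_mul_assoc, mul_smul_comm]
  · rw [← sum_antipode_tmul_one_mul_comul r, Finset.sum_mul, hS', TensorProduct.sum_tmul,
      Finset.sum_mul]
    refine Finset.sum_congr rfl fun i _ => ?_
    rw [mul_assoc, ← Bialgebra.comul_mul, hΛl, map_smul, ← TensorProduct.smul_tmul',
      smul_mul_assoc, mul_smul_comm]
end

section
/- Let H be a finite-dimensional Hopf algebra over a field k with a left integral Λ and a right cointegral λ satisfying λ(Λ) = 1. Then the Frobenius map Ψ : H → H*, defined by Ψ(a) = (y ↦ λ(S(a)·y)), is a linear isomorphism, and its inverse is given by Ψ⁻¹(φ) = Σ φ(Λ₍₁₎)·Λ₍₂₎ = (φ⊗id)(Δ(Λ)). -/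
open scoped TensorProduct

/-- The Frobenius map `Ψ : H → H*`, `Ψ(a) = (y ↦ lam (S(a)·y))`. -/
noncomputable def frobeniusMap (k H : Type) [Field k] [Ring H] [HopfAlgebra k H]
    (lam : H →ₗ[k] k) (a : H) : H →ₗ[k] k :=
  lam ∘ₗ LinearMap.mulLeft k (HopfAlgebra.antipode (R := k) a)

/-- `Σ (S(a₍₁₎) ⊗ 1) · Δ(a₍₂₎) = 1 ⊗ a`. -/
theorem sum_antipode_tmul_one_mul_comul_s15 {k H : Type} [Field k] [Ring H] [HopfAlgebra k H] {a : H}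
    {ι : Type*} (r : Coalgebra.Repr k a ι) :
    ∑ i ∈ r.index, (HopfAlgebra.antipode (R := k) (r.left i) ⊗ₜ[k] (1 : H)) *
      Coalgebra.comul (R := k) (r.right i) = 1 ⊗ₜ[k] a := by
  let T : H ⊗[k] H →ₗ[k] H := LinearMap.mul' k H ∘ₗ (HopfAlgebra.antipode k).rTensor H
  have hT (x : H) (t : H ⊗[k] H) :
      (HopfAlgebra.antipode (R := k) x ⊗ₜ[k] (1 : H)) * t =
        T.rTensor H ((TensorProduct.assoc k H H H).symm (x ⊗ₜ t)) := by
    induction t with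
    | zero => simp
    | add t u ht hu => simp only [mul_add, TensorProduct.tmul_add, map_add, ht, hu]
    | tmul y z => simp [T]
  have hc : T ∘ₗ Coalgebra.comul = Algebra.linearMap k H ∘ₗ Coalgebra.counit := by
    simp only [T, LinearMap.comp_assoc, HopfAlgebra.mul_antipode_rTensor_comul]
  calc
    _ = T.rTensor H ((TensorProduct.assoc k H H H).symm
          (Coalgebra.comul.lTensor H (Coalgebra.comul (R := k) a))) := by
      simp only [hT, ← r.eq, map_sum, LinearMap.lTensor_tmul]
    _ = (Algebra.linearMap k H).rTensor H
          (Coalgebra.counit.rTensor H (Coalgebra.comul (R := k) a)) := by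
      rw [Coalgebra.coassoc_symm_apply, ← LinearMap.rTensor_comp_apply, hc,
        LinearMap.rTensor_comp_apply]
    _ = 1 ⊗ₜ[k] a := by
      rw [Coalgebra.rTensor_counit_comul, LinearMap.rTensor_tmul, Algebra.linearMap_apply, map_one]

/-- For a left integral `Λ`, `Σ Λ₍₁₎ ⊗ a Λ₍₂₎ = Σ S(a) Λ₍₁₎ ⊗ Λ₍₂₎`. -/
theorem one_tmul_mul_comul_of_left_integral {k H : Type} [Field k] [Ring H] [HopfAlgebra k H]
    {Λ : H} (hΛ : ∀ h : H, h * Λ = Coalgebra.counit (R := k) h • Λ) (a : H) :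
    (1 ⊗ₜ[k] a) * Coalgebra.comul (R := k) Λ =
      (HopfAlgebra.antipode (R := k) a ⊗ₜ[k] (1 : H)) * Coalgebra.comul (R := k) Λ := by
  let r := Coalgebra.Repr.arbitrary k a
  have ha : ∑ i ∈ r.index, Coalgebra.counit (R := k) (r.right i) • r.left i = a := by
    simpa only [map_sum, TensorProduct.rid_tmul, one_smul] using
      congrArg (TensorProduct.rid k H) (Coalgebra.sum_tmul_counit_eq r)
  rw [← sum_antipode_tmul_one_mul_comul_s15 r, Finset.sum_mul]
  conv_rhs => rw [← ha]
  simp only [mul_assoc, ← Bialgebra.comul_mul, hΛ, map_smul, map_sum, TensorProduct.sum_tmul,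
    Finset.sum_mul, mul_smul_comm, ← TensorProduct.smul_tmul', smul_mul_assoc]

theorem pairLeft_comp_mulLeft {k H : Type} [Field k] [Ring H] [Algebra k H]
    (φ : H →ₗ[k] k) (b : H) (t : H ⊗[k] H) :
    pairLeft k H (φ ∘ₗ LinearMap.mulLeft k b) t = pairLeft k H φ ((b ⊗ₜ[k] (1 : H)) * t) := by
  induction t with
  | zero => simp
  | add t u ht hu => simp only [mul_add, map_add, ht, hu]
  | tmul y z => simp [pairLeft]

theorem pairLeft_one_tmul_mul {k H : Type} [Field k] [Ring H] [Algebra k H]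
    (φ : H →ₗ[k] k) (a : H) (t : H ⊗[k] H) :
    pairLeft k H φ ((1 ⊗ₜ[k] a) * t) = a * pairLeft k H φ t := by
  induction t with
  | zero => simp
  | add t u ht hu => simp only [mul_add, map_add, ht, hu]
  | tmul y z => simp [pairLeft]

/-- For a finite-dimensional Hopf algebra `H` with left integral `Λ` and right
cointegral `lam` normalized by `lam Λ = 1`, the Frobenius map `Ψ(a) = (y ↦ lam (S(a)·y))` is a
linear isomorphism with inverse `φ ↦ (φ ⊗ id)(Δ(Λ)) = Σ φ(Λ₍₁₎)·Λ₍₂₎`. -/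
theorem frobenius_map_bijective_with_inverse
    (k H : Type) [Field k] [Ring H] [HopfAlgebra k H] [FiniteDimensional k H]
    (Λ : H) (hΛ : ∀ h : H, h * Λ = Coalgebra.counit (R := k) h • Λ)
    (lam : H →ₗ[k] k)
    (hlam : ∀ h : H, pairLeft k H lam (Coalgebra.comul (R := k) h) = lam h • (1 : H))
    (hnorm : lam Λ = 1) :
    Function.Bijective (frobeniusMap k H lam) ∧
    (∀ φ : H →ₗ[k] k,
      frobeniusMap k H lam (pairLeft k H φ (Coalgebra.comul (R := k) Λ)) = φ) ∧
    (∀ a : H,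
      pairLeft k H (frobeniusMap k H lam a) (Coalgebra.comul (R := k) Λ) = a) := by
  have left_inv (a : H) :
      pairLeft k H (frobeniusMap k H lam a) (Coalgebra.comul (R := k) Λ) = a := by
    rw [frobeniusMap, pairLeft_comp_mulLeft, ← one_tmul_mul_comul_of_left_integral hΛ,
      pairLeft_one_tmul_mul, hlam, hnorm, one_smul, mul_one]
  let Ψ : H →ₗ[k] (H →ₗ[k] k) :=
    { toFun := frobeniusMap k H lam
      map_add' := fun a b => by ext y; simp [frobeniusMap, add_mul]
      map_smul' := fun c a => by ext y; simp [frobeniusMap] }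
  have inj : Function.Injective Ψ := Function.LeftInverse.injective
    (g := fun φ => pairLeft k H φ (Coalgebra.comul (R := k) Λ)) left_inv
  have surj : Function.Surjective Ψ :=
    (LinearMap.injective_iff_surjective_of_finrank_eq_finrank
      (Subspace.dual_finrank_eq (K := k) (V := H)).symm).mp inj
  refine ⟨⟨inj, surj⟩, fun φ => ?_, left_inv⟩
  obtain ⟨a, rfl⟩ := surj φ
  exact congrArg (frobeniusMap k H lam) (left_inv a)
end
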